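/- Let S_c be a scored ℕA-set. Then S_c is finitely generated as an ℕA-set if and only if F_σ(S_c) is finitely generated as an F_σ(ℕA)-set for each facet σ of the cone ℝ≥0·A. -/

import Mathlib

open Function

/-- Lattice `ℤ^d`. -/
abbrev Zd (d : ℕ) := Fin d → ℤ

noncomputable section

namespace SaitoTakahashi

variable {d : ℕ}

/-- The affine semigroup `ℕA` generated by the finite set `A ⊆ ℤ^d`. -/
def NA (A : Finset (Zd d)) : AddSubmonoid (Zd d) := AddSubmonoid.closure (A : Set (Zd d))

/-- The group `ℤA` generated by `A`. -/
def ZA (A : Finset (Zd d)) : AddSubgroup (Zd d) := AddSubgroup.closure (A : Set (Zd d))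

/-- Realification of a lattice point. -/
def toR (a : Zd d) : Fin d → ℝ := fun i => (a i : ℝ)

/-- The real cone `ℝ≥0 A`. -/
def coneOf (A : Finset (Zd d)) : Set (Fin d → ℝ) :=
  { x | ∃ c : Zd d → ℝ, (∀ a, 0 ≤ c a) ∧ x = ∑ a ∈ A, c a • toR a }

/-- The cone `ℝ≥0 A` is strongly convex. -/
def StronglyConvex (A : Finset (Zd d)) : Prop :=
  ∀ x ∈ coneOf A, -x ∈ coneOf A → x = 0

/-- `B = A ∩ τ` for a face `τ` of the cone `ℝ≥0 A`, i.e. `B` is the subset of `A`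
cut out by an integral supporting functional which is nonnegative on `A`. -/
def IsFace (A B : Finset (Zd d)) : Prop :=
  ∃ G : Zd d →+ ℤ, B ⊆ A ∧ (∀ a ∈ A, 0 ≤ G a) ∧ ∀ a ∈ A, (G a = 0 ↔ a ∈ B)

/-- `F` is the primitive integral support function of a facet of `ℝ≥0 A`:
nonnegative on the cone, surjective onto `ℤ` (primitivity, using `ℤA = ℤ^d`),
and its zero set in the cone is a face of dimension `d - 1`. -/
def IsFacetFn (A : Finset (Zd d)) (F : Zd d →+ ℤ) : Prop :=
  (∀ a ∈ A, 0 ≤ F a) ∧ Surjective F ∧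
    Module.finrank ℝ ↥(Submodule.span ℝ (toR '' {a : Zd d | a ∈ A ∧ F a = 0})) = d - 1

/-- The set `A ∩ σ` for the facet with primitive integral support function `F`. -/
def facetSet (A : Finset (Zd d)) (F : Zd d →+ ℤ) : Finset (Zd d) :=
  A.filter fun a => F a = 0

/-- `S` is an `ℕA`-set: `S + ℕA ⊆ S`. -/
def IsNASet (A : Finset (Zd d)) (S : Set (Zd d)) : Prop :=
  ∀ s ∈ S, ∀ a ∈ NA A, s + a ∈ S

/-- `S` is a finitely generated `ℕA`-set. -/
def IsFGNASet (A : Finset (Zd d)) (S : Set (Zd d)) : Prop :=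
  IsNASet A S ∧ ∃ G : Finset (Zd d), S = { x | ∃ g ∈ G, ∃ a ∈ NA A, x = g + a }

/-- `S` is scored: `S = ⋂_{σ facet} { a ∈ ℤ^d : F_σ(a) ∈ F_σ(S) }`. -/
def IsScored (A : Finset (Zd d)) (S : Set (Zd d)) : Prop :=
  S = { x : Zd d | ∀ F : Zd d →+ ℤ, IsFacetFn A F → F x ∈ F '' S }

/-- `S + ℤ(A ∩ τ)` where `B = A ∩ τ`. -/
def plusZ (S : Set (Zd d)) (B : Finset (Zd d)) : Set (Zd d) :=
  { x | ∃ s ∈ S, ∃ z ∈ AddSubgroup.closure (B : Set (Zd d)), x = s + z }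

/-- The coset `b + ℤ(A ∩ τ)` where `B = A ∩ τ`. -/
def coset (b : Zd d) (B : Finset (Zd d)) : Set (Zd d) :=
  { x | x - b ∈ AddSubgroup.closure (B : Set (Zd d)) }

/-- The standard-expression setting of the paper:
`S = S_c \ ⋃ᵢ (bᵢ + ℤ(A∩τᵢ))`, where `S_c` is a finitely generated scored
`ℕA`-set (the scored closure of `S`), `bᵢ ∈ S_c`, the `τᵢ` are faces of `ℝ≥0 A`
(encoded by `Bf i = A ∩ τᵢ`), and `F_σ(S) = F_σ(S_c)` for every facet `σ`. -/
structure Setting (A : Finset (Zd d)) (Sc S : Set (Zd d)) {m : ℕ}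
    (b : Fin m → Zd d) (Bf : Fin m → Finset (Zd d)) : Prop where
  latt : ZA A = ⊤
  convex : StronglyConvex A
  fg : IsFGNASet A Sc
  scored : IsScored A Sc
  bIn : ∀ i, b i ∈ Sc
  face : ∀ i, IsFace A (Bf i)
  expr : S = Sc \ ⋃ i, coset (b i) (Bf i)
  sameF : ∀ F : Zd d →+ ℤ, IsFacetFn A F → F '' S = F '' Sc

/-- The expression `S = S_c \ ⋃ᵢ (bᵢ + ℤ(A∩τᵢ))` is irredundant. -/
def Irredundant (Sc S : Set (Zd d)) {m : ℕ}
    (b : Fin m → Zd d) (Bf : Fin m → Finset (Zd d)) : Prop :=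
  ∀ i, Sc \ ⋃ j, ⋃ (_ : j ≠ i), coset (b j) (Bf j) ≠ S

section Kside

variable (K : Type) [Field K]

/-- A lattice point as a point of `K^d`. -/
def toK (a : Zd d) : Fin d → K := fun i => (a i : K)

/-- The vanishing ideal `𝕀(V) ⊆ K[s₁,…,s_d]` of a subset `V ⊆ K^d`. -/
def vIdeal (V : Set (Fin d → K)) : Ideal (MvPolynomial (Fin d) K) :=
  ⨅ v ∈ V, RingHom.ker (MvPolynomial.eval v)

/-- `Ω_{S,S'}(a) = S \ (−a + S')`. -/
def Omega (S S' : Set (Zd d)) (a : Zd d) : Set (Zd d) := S \ { x | a + x ∈ S' }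

/-- The `K`-algebra map `f(s) ↦ f(s − c)`. -/
def shiftHom (c : Fin d → K) : MvPolynomial (Fin d) K →+* MvPolynomial (Fin d) K :=
  MvPolynomial.eval₂Hom MvPolynomial.C (fun i => MvPolynomial.X i - MvPolynomial.C (c i))

/-- The translate `I + c = { f(s − c) : f ∈ I }` of an ideal of `K[s]`. -/
def shiftIdeal (I : Ideal (MvPolynomial (Fin d) K)) (c : Fin d → K) :
    Ideal (MvPolynomial (Fin d) K) :=
  I.map (shiftHom K c)

/-- The `K`-span `Kτ` of a face, where `B = A ∩ τ`. -/
def spanK (B : Finset (Zd d)) : Submodule K (Fin d → K) :=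
  Submodule.span K (toK K '' (B : Set (Zd d)))

/-- `lam` is (a representative of) an element of `E(S)_τ(α)`:
`lam ∈ Kτ` and `α − lam ∈ S + ℤ(A∩τ)`, where `B = A ∩ τ`. -/
def memE (S : Set (Zd d)) (B : Finset (Zd d)) (α lam : Fin d → K) : Prop :=
  lam ∈ spanK K B ∧
    ∃ s ∈ S, ∃ z ∈ AddSubgroup.closure (B : Set (Zd d)), α - lam = toK K s + toK K z

/-- The `K`-linear extension of an integral linear form `F` to `K^d`. -/
def FK (F : Zd d →+ ℤ) (v : Fin d → K) : K :=
  ∑ i, ((F (Pi.single i 1) : ℤ) : K) * v i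

/-- The affine translate `α + Kτ ⊆ K^d`, where `B = A ∩ τ`. -/
def aff (α : Fin d → K) (B : Finset (Zd d)) : Set (Fin d → K) :=
  { x | ∃ lam ∈ spanK K B, x = α + lam }

end Kside

end SaitoTakahashi

namespace SaitoTakahashi

/-- `M ⊆ ℤ` is a finitely generated `F(ℕA)`-set. -/
def IsFGFSet {d : ℕ} (A : Finset (Zd d)) (F : Zd d →+ ℤ) (M : Set ℤ) : Prop :=
  ∃ G : Finset ℤ, M = { x | ∃ g ∈ G, ∃ a ∈ NA A, x = g + F a }


end SaitoTakahashi

namespace SaitoTakahashi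

theorem farkas {ι V : Type*} [AddCommGroup V] [Module ℚ V] (s : Finset ι) :
    ∀ (v : ι → V) (x : V), (∃ c : ι → ℚ, (∀ i, 0 ≤ c i) ∧ x = ∑ i ∈ s, c i • v i) ∨
      ∃ f : V →ₗ[ℚ] ℚ, (∀ i ∈ s, 0 ≤ f (v i)) ∧ f x < 0 := by
  classical
  induction s using Finset.induction_on with
  | empty =>
    intro v x
    by_cases hx : x = 0
    · left; exact ⟨0, by simp, by simp [hx]⟩
    · right
      have : ∃ f : Module.Dual ℚ V, f x ≠ 0 := by
        by_contra h
        push Not at h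
        exact hx ((Module.forall_dual_apply_eq_zero_iff ℚ x).1 h)
      obtain ⟨f, hf⟩ := this
      rcases lt_or_gt_of_ne hf with h | h
      · exact ⟨f, by simp, h⟩
      · exact ⟨-f, by simp, by simpa using h⟩
  | insert j s hj ih =>
    intro v x
    rcases ih v x with ⟨c, hc, hx⟩ | ⟨f, hf, hfx⟩
    · left
      refine ⟨fun i => if i = j then 0 else c i, fun i => ?_, ?_⟩
      · dsimp only; split_ifs; exacts [le_rfl, hc i]
      · rw [Finset.sum_insert hj, hx]
        simp only [if_true, zero_smul, zero_add]
        refine Finset.sum_congr rfl fun i hi => ?_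
        rw [if_neg (ne_of_mem_of_not_mem hi hj)]
    · by_cases hfj : 0 ≤ f (v j)
      · right
        refine ⟨f, fun i hi => ?_, hfx⟩
        rcases Finset.mem_insert.1 hi with rfl | hi
        exacts [hfj, hf i hi]
      · push Not at hfj
        rcases ih (fun i => v i - (f (v i) / f (v j)) • v j) (x - (f x / f (v j)) • v j) with
          ⟨c, hc, hx⟩ | ⟨g, hg, hgx⟩
        · left
          refine ⟨fun i => if i = j then f x / f (v j) - ∑ i ∈ s, c i * (f (v i) / f (v j)) else c i,
            fun i => ?_, ?_⟩
          · dsimp only; split_ifs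
            · have h1 : 0 ≤ f x / f (v j) := div_nonneg_of_nonpos hfx.le hfj.le
              have h2 : ∑ i ∈ s, c i * (f (v i) / f (v j)) ≤ 0 := by
                refine Finset.sum_nonpos fun i hi => ?_
                exact mul_nonpos_of_nonneg_of_nonpos (hc i)
                  (div_nonpos_of_nonneg_of_nonpos (hf i hi) hfj.le)
              linarith
            · exact hc i
          · rw [Finset.sum_insert hj]
            simp only [if_true]
            have : ∑ i ∈ s, (if i = j then f x / f (v j) - ∑ i ∈ s, c i * (f (v i) / f (v j)) else c i) • v i
                = ∑ i ∈ s, c i • v i := by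
              refine Finset.sum_congr rfl fun i hi => ?_
              rw [if_neg (ne_of_mem_of_not_mem hi hj)]
            rw [this]
            simp only [smul_sub, Finset.sum_sub_distrib, smul_smul] at hx
            rw [← Finset.sum_smul] at hx
            rw [sub_smul]
            rw [sub_eq_iff_eq_add] at hx
            refine hx.trans ?_
            abel
        · right
          refine ⟨g - (g (v j) / f (v j)) • f, fun i hi => ?_, ?_⟩
          · rcases Finset.mem_insert.1 hi with rfl | hi
            · simp [div_mul_cancel₀ _ hfj.ne]
            · have := hg i hi
              simp only [map_sub, map_smul, smul_eq_mul, LinearMap.sub_apply,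
                LinearMap.smul_apply] at this ⊢
              convert this using 2
              ring
          · simp only [map_sub, map_smul, smul_eq_mul, LinearMap.sub_apply,
                LinearMap.smul_apply] at hgx ⊢
            convert hgx using 2
            ring

def toQ {d : ℕ} (a : Zd d) : Fin d → ℚ := fun i => (a i : ℚ)

theorem finrank_le_aux {d : ℕ} (K L : Type) [Field K] [Field L] [CharZero K] [CharZero L]
    (T : Set (Zd d)) :
    Module.finrank K (Submodule.span K ((fun a : Zd d => fun i => (a i : K)) '' T)) ≤
    Module.finrank L (Submodule.span L ((fun a : Zd d => fun i => (a i : L)) '' T)) := by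
  obtain ⟨f, hf, hspan, hli⟩ := Submodule.exists_fun_fin_finrank_span_eq K
    ((fun a : Zd d => fun i => (a i : K)) '' T)
  choose g hgT hg using hf
  have h1 : LinearIndependent K (fun i => algebraMap ℤ K ∘ g i) := by
    have : (fun i => algebraMap ℤ K ∘ g i) = f := by
      funext i; rw [← hg i]; rfl
    rw [this]; exact hli
  rw [linearIndependent_algebraMap_comp_iff] at h1
  have h2 : LinearIndependent L (fun i => algebraMap ℤ L ∘ g i) :=
    linearIndependent_algebraMap_comp_iff.2 h1
  have h3 : LinearIndependent L (fun i => (⟨algebraMap ℤ L ∘ g i,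
      Submodule.subset_span ⟨g i, hgT i, rfl⟩⟩ :
      Submodule.span L ((fun a : Zd d => fun i => (a i : L)) '' T))) := by
    apply LinearIndependent.of_comp (Submodule.subtype _)
    exact h2
  simpa using h3.fintype_card_le_finrank

theorem finrank_R_eq_Q {d : ℕ} (T : Set (Zd d)) :
    Module.finrank ℝ (Submodule.span ℝ (toR '' T)) =
    Module.finrank ℚ (Submodule.span ℚ (toQ '' T)) :=
  le_antisymm (finrank_le_aux ℝ ℚ T) (finrank_le_aux ℚ ℝ T)

theorem toQ_add {d : ℕ} (a b : Zd d) : toQ (a + b) = toQ a + toQ b := by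
  ext i; simp [toQ]
theorem toQ_neg {d : ℕ} (a : Zd d) : toQ (-a) = -toQ a := by
  ext i; simp [toQ]
theorem toQ_zero {d : ℕ} : toQ (0 : Zd d) = 0 := by
  ext i; simp [toQ]

def toQHom (d : ℕ) : Zd d →+ (Fin d → ℚ) where
  toFun := toQ
  map_zero' := toQ_zero
  map_add' := toQ_add

/-- extension of an integral form to ℚ -/
theorem exists_ext {d : ℕ} (F : Zd d →+ ℤ) : ∃ f : (Fin d → ℚ) →ₗ[ℚ] ℚ, ∀ x, f (toQ x) = F x := by
  refine ⟨∑ i, ((F (Pi.single i 1) : ℤ) : ℚ) • LinearMap.proj i, fun x => ?_⟩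
  have : x = ∑ i, x i • (Pi.single i 1 : Zd d) := by
    ext j; simp [Finset.sum_apply, Pi.single_apply]
  conv_rhs => rw [this, map_sum]
  simp only [map_zsmul]
  simp [toQ, mul_comm]

theorem span_toQ_top {d : ℕ} (A : Finset (Zd d)) (hZ : ZA A = ⊤) :
    Submodule.span ℚ (toQ '' (A : Set (Zd d))) = ⊤ := by
  have h : ∀ x : Zd d, toQ x ∈ Submodule.span ℚ (toQ '' (A : Set (Zd d))) := by
    intro x
    have hx : x ∈ ZA A := by rw [hZ]; trivial
    unfold ZA at hx
    induction hx using AddSubgroup.closure_induction with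
    | mem x hx => exact Submodule.subset_span ⟨x, hx, rfl⟩
    | zero => rw [toQ_zero]; exact zero_mem _
    | add x y _ _ hx hy => rw [toQ_add]; exact add_mem hx hy
    | neg x _ hx => rw [toQ_neg]; exact neg_mem hx
  rw [eq_top_iff]
  intro y _
  have : y = ∑ i, y i • toQ (Pi.single i 1 : Zd d) := by
    ext j; simp [toQ, Finset.sum_apply, Pi.single_apply]
  rw [this]
  exact sum_mem fun i _ => Submodule.smul_mem _ _ (h _)

/-- primitive integral multiple of a rational form -/
theorem exists_prim {d : ℕ} (f : (Fin d → ℚ) →ₗ[ℚ] ℚ) (hf : f ≠ 0) :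
    ∃ (F : Zd d →+ ℤ) (q : ℚ), 0 < q ∧ Surjective F ∧ ∀ x, (F x : ℚ) = q * f (toQ x) := by
  classical
  let N : ℕ := ∏ i, (f (Pi.single i 1)).den
  have hN : 0 < N := Finset.prod_pos fun i _ => (f (Pi.single i 1)).den_pos
  have h1 : ∀ i, ∃ z : ℤ, (z : ℚ) = N * f (Pi.single i 1) := by
    intro i
    obtain ⟨k, hk⟩ : (f (Pi.single i 1)).den ∣ N := Finset.dvd_prod_of_mem _ (Finset.mem_univ i)
    refine ⟨k * (f (Pi.single i 1)).num, ?_⟩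
    rw [hk]
    push_cast
    conv_lhs => rw [← Rat.mul_den_eq_num]
    ring
  choose z hz using h1
  have hfx : ∀ x : Zd d, f (toQ x) = ∑ i, (x i : ℚ) * f (Pi.single i 1) := by
    intro x
    have : toQ x = ∑ i, (x i : ℚ) • (Pi.single i 1 : Fin d → ℚ) := by
      ext j; simp [toQ, Finset.sum_apply, Pi.single_apply]
    rw [this, map_sum]; simp
  let G : Zd d →+ ℤ := ⟨⟨fun x => ∑ i, x i * z i, by simp⟩, by
    intro x y; simp [add_mul, Finset.sum_add_distrib]⟩
  have hG : ∀ x, (G x : ℚ) = N * f (toQ x) := by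
    intro x
    change ((∑ i, x i * z i : ℤ) : ℚ) = _
    rw [hfx, Finset.mul_sum]
    push_cast
    refine Finset.sum_congr rfl fun i _ => ?_
    rw [hz]; ring
  obtain ⟨n, hn⟩ := Int.subgroup_cyclic G.range
  rw [← AddSubgroup.zmultiples_eq_closure] at hn
  have hdvd : ∀ x, n ∣ G x := by
    intro x
    have : G x ∈ AddSubgroup.zmultiples n := hn ▸ ⟨x, rfl⟩
    exact Int.mem_zmultiples_iff.1 this
  have hn0 : n ≠ 0 := by
    rintro rfl
    apply hf
    apply LinearMap.pi_ext'
    intro i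
    ext
    have h0 : G (Pi.single i 1) = 0 := by simpa using hdvd (Pi.single i 1)
    have h2 := hG (Pi.single i 1)
    rw [h0] at h2
    have h3 : toQ (Pi.single i 1 : Zd d) = Pi.single i 1 := by
      ext j; simp [toQ, Pi.single_apply]
    rw [h3] at h2
    have : (N : ℚ) ≠ 0 := by positivity
    simpa [this] using h2.symm
  have hdvd' : ∀ x, |n| ∣ G x := fun x => (abs_dvd _ _).2 (hdvd x)
  have hnq : (0:ℚ) < |(n:ℚ)| := by simpa using hn0
  have hdiv : ∀ x, ((G x / |n| : ℤ) : ℚ) = G x / |(n:ℚ)| := by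
    intro x
    rw [Int.cast_div (hdvd' x) (by exact_mod_cast hnq.ne')]
    simp
  refine ⟨⟨⟨fun x => G x / |n|, by simp⟩, ?_⟩, N / |(n:ℚ)|, by positivity, ?_, ?_⟩
  · intro x y
    change G (x+y) / |n| = G x / |n| + G y / |n|
    rw [map_add, Int.add_ediv_of_dvd_left (hdvd' x)]
  · intro k
    have : |n| * k ∈ G.range := by
      rw [hn, Int.mem_zmultiples_iff, ← abs_dvd]
      exact dvd_mul_right _ _
    obtain ⟨x, hx⟩ := this
    refine ⟨x, ?_⟩
    change G x / |n| = k
    rw [hx, Int.mul_ediv_cancel_left]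
    simpa using hn0
  · intro x
    change ((G x / |n| : ℤ) : ℚ) = _
    rw [hdiv, hG]; ring

end SaitoTakahashi

namespace SaitoTakahashi

theorem exists_facet {d : ℕ} (A : Finset (Zd d)) (hZ : ZA A = ⊤) (x : Zd d)
    (f₀ : (Fin d → ℚ) →ₗ[ℚ] ℚ) (h₀ : ∀ a ∈ A, 0 ≤ f₀ (toQ a)) (hx₀ : f₀ (toQ x) < 0) :
    ∃ F : Zd d →+ ℤ, IsFacetFn A F ∧ F x < 0 := by
  classical
  let Z : ((Fin d → ℚ) →ₗ[ℚ] ℚ) → Set (Zd d) := fun f => {a | a ∈ A ∧ f (toQ a) = 0}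
  let W : ((Fin d → ℚ) →ₗ[ℚ] ℚ) → Submodule ℚ (Fin d → ℚ) := fun f => Submodule.span ℚ (toQ '' Z f)
  have hWker : ∀ f, W f ≤ LinearMap.ker f := by
    intro f
    refine Submodule.span_le.2 ?_
    rintro _ ⟨a, ha, rfl⟩
    exact ha.2
  have hWlt : ∀ f, f (toQ x) < 0 → Module.finrank ℚ (W f) < d := by
    intro f hf
    have : W f < ⊤ := by
      rw [lt_top_iff_ne_top]
      intro h
      have : toQ x ∈ W f := by rw [h]; trivial
      have := hWker f this
      rw [LinearMap.mem_ker] at this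
      exact hf.ne this
    simpa using Submodule.finrank_lt this.ne
  let P : Set ℕ := {n | ∃ f : (Fin d → ℚ) →ₗ[ℚ] ℚ, (∀ a ∈ A, 0 ≤ f (toQ a)) ∧ f (toQ x) < 0 ∧
    Module.finrank ℚ (W f) = n}
  have hPne : P.Nonempty := ⟨_, f₀, h₀, hx₀, rfl⟩
  have hPb : BddAbove P := ⟨d, by rintro n ⟨f, _, hf, rfl⟩; exact (hWlt f hf).le⟩
  obtain ⟨f, hfA, hfx, hfn⟩ := Nat.sSup_mem hPne hPb
  have hmax : ∀ g : (Fin d → ℚ) →ₗ[ℚ] ℚ, (∀ a ∈ A, 0 ≤ g (toQ a)) → g (toQ x) < 0 →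
      Module.finrank ℚ (W g) ≤ Module.finrank ℚ (W f) := by
    intro g h1 h2
    rw [hfn]
    exact le_csSup hPb ⟨g, h1, h2, rfl⟩
  have hdim : Module.finrank ℚ (W f) = d - 1 := by
    by_contra hne
    have hlt := hWlt f hfx
    have hlt2 : Module.finrank ℚ (W f) + 1 < d := by omega
    have hsup : W f ⊔ Submodule.span ℚ {toQ x} < ⊤ := by
      rw [lt_top_iff_ne_top]
      intro h
      have h1 := Submodule.finrank_add_le_finrank_add_finrank (W f) (Submodule.span ℚ {toQ x})
      rw [h] at h1
      have h2 : Module.finrank ℚ (Submodule.span ℚ {toQ x}) ≤ 1 := by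
        simpa using finrank_span_le_card (R := ℚ) ({toQ x} : Set (Fin d → ℚ))
      simp at h1
      omega
    obtain ⟨g, hg0, hg⟩ := Submodule.exists_le_ker_of_lt_top _ hsup
    have hgx : g (toQ x) = 0 :=
      hg (Submodule.mem_sup_right (Submodule.mem_span_singleton_self _))
    have hgW : ∀ w ∈ W f, g w = 0 := fun w hw => hg (Submodule.mem_sup_left hw)
    -- wlog negative somewhere
    have : ∃ g : (Fin d → ℚ) →ₗ[ℚ] ℚ, g (toQ x) = 0 ∧ (∀ w ∈ W f, g w = 0) ∧
        ∃ a ∈ A, g (toQ a) < 0 := by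
      have : ∃ a ∈ A, g (toQ a) ≠ 0 := by
        by_contra h
        push Not at h
        apply hg0
        have : (⊤ : Submodule ℚ (Fin d → ℚ)) ≤ LinearMap.ker g := by
          rw [← span_toQ_top A hZ, Submodule.span_le]
          rintro _ ⟨a, ha, rfl⟩
          exact h a ha
        exact LinearMap.ker_eq_top.1 (top_le_iff.1 this)
      obtain ⟨a, ha, hga⟩ := this
      rcases lt_or_gt_of_ne hga with h | h
      · exact ⟨g, hgx, hgW, a, ha, h⟩
      · exact ⟨-g, by simp [hgx], fun w hw => by simp [hgW w hw], a, ha, by simpa using h⟩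
    obtain ⟨g, hgx, hgW, a₁, ha₁, hga₁⟩ := this
    obtain ⟨a, haN, hamin⟩ := (A.filter fun a => g (toQ a) < 0).exists_min_image
      (fun a => f (toQ a) / (- g (toQ a))) ⟨a₁, by simp [ha₁, hga₁]⟩
    rw [Finset.mem_filter] at haN
    obtain ⟨haA, hga⟩ := haN
    set t : ℚ := f (toQ a) / (- g (toQ a)) with ht
    have ht0 : 0 ≤ t := div_nonneg (hfA a haA) (by linarith)
    let h : (Fin d → ℚ) →ₗ[ℚ] ℚ := f + t • g
    have hh : ∀ y, h y = f y + t * g y := fun y => by simp [h]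
    have hle := hmax h (by
      intro b hb
      rw [hh]
      by_cases hgb : g (toQ b) < 0
      · have := hamin b (by simp [hb, hgb])
        rw [le_div_iff₀ (by linarith)] at this
        linarith
      · push Not at hgb
        have := hfA b hb
        positivity) (by rw [hh, hgx]; simpa using hfx)
    have hha : h (toQ a) = 0 := by
      rw [hh, ht]; field_simp [hga.ne]; ring
    have hsub : W f ≤ W h := by
      refine Submodule.span_mono (Set.image_mono ?_)
      rintro b ⟨hb, hfb⟩
      refine ⟨hb, ?_⟩
      rw [hh, hfb, hgW (toQ b) (Submodule.subset_span ⟨b, ⟨hb, hfb⟩, rfl⟩)]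
      simp
    have heq := Submodule.eq_of_le_of_finrank_le hsub hle
    have : toQ a ∈ W f := by
      rw [heq]; exact Submodule.subset_span ⟨a, ⟨haA, hha⟩, rfl⟩
    exact hga.ne (hgW _ this)
  obtain ⟨F, q, hq, hs, hF⟩ := exists_prim f (by rintro rfl; simp at hfx)
  refine ⟨F, ⟨fun a ha => ?_, hs, ?_⟩, ?_⟩
  · have : (0:ℚ) ≤ F a := by rw [hF]; exact mul_nonneg hq.le (hfA a ha)
    exact_mod_cast this
  · rw [finrank_R_eq_Q, ← hdim]
    have : {a : Zd d | a ∈ A ∧ F a = 0} = Z f := by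
      ext a
      have : F a = 0 ↔ f (toQ a) = 0 := by
        rw [← Int.cast_eq_zero (α := ℚ), hF]; simp [hq.ne']
      simp [Z, this]
    rw [this]
  · have : (F x : ℚ) < 0 := by rw [hF]; exact mul_neg_of_pos_of_neg hq hfx
    exact_mod_cast this

theorem mem_cone {d : ℕ} (A : Finset (Zd d)) (hZ : ZA A = ⊤) (x : Zd d)
    (hx : ∀ F : Zd d →+ ℤ, IsFacetFn A F → 0 ≤ F x) :
    ∃ c : Zd d → ℚ, (∀ a, 0 ≤ c a) ∧ toQ x = ∑ a ∈ A, c a • toQ a := by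
  rcases farkas A toQ (toQ x) with h | ⟨f, hf, hfx⟩
  · exact h
  · obtain ⟨F, hF, hlt⟩ := exists_facet A hZ x f hf hfx
    exact absurd (hx F hF) (not_le.2 hlt)

theorem exists_pos {d : ℕ} (A : Finset (Zd d)) (hZ : ZA A = ⊤) (F : Zd d →+ ℤ)
    (hF : IsFacetFn A F) : ∃ a ∈ A, 0 < F a := by
  by_contra h
  push Not at h
  have h0 : ∀ a ∈ A, F a = 0 := fun a ha => le_antisymm (h a ha) (hF.1 a ha)
  obtain ⟨u, hu⟩ := hF.2.1 1
  have hle : ZA A ≤ F.ker := by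
    unfold ZA
    rw [AddSubgroup.closure_le]
    intro a ha
    exact h0 a ha
  have : u ∈ F.ker := hle (by rw [hZ]; trivial)
  rw [AddMonoidHom.mem_ker] at this
  omega

theorem facets_finite {d : ℕ} (A : Finset (Zd d)) (hZ : ZA A = ⊤) :
    {F : Zd d →+ ℤ | IsFacetFn A F}.Finite := by
  classical
  refine Set.Finite.of_injOn (f := facetSet A) (t := (A.powerset : Set (Finset (Zd d)))) ?_ ?_
    (Finset.finite_toSet _)
  · intro F _
    exact Finset.mem_coe.2 (Finset.mem_powerset.2 (Finset.filter_subset _ _))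
  · intro F hF G hG hFG
    have hz : ∀ a ∈ A, (F a = 0 ↔ G a = 0) := by
      intro a ha
      have : a ∈ facetSet A F ↔ a ∈ facetSet A G := by rw [hFG]
      simpa [facetSet, ha] using this
    obtain ⟨a, ha, hFa⟩ := exists_pos A hZ F hF
    have hGa : 0 < G a := lt_of_le_of_ne (hG.1 a ha) fun h => by
      have := (hz a ha).2 h.symm
      omega
    obtain ⟨f, hf⟩ := exists_ext F
    obtain ⟨g, hg⟩ := exists_ext G
    have hkey : (G a : ℚ) • f - (F a : ℚ) • g = 0 := by
      set h := (G a : ℚ) • f - (F a : ℚ) • g with hh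
      set W := Submodule.span ℚ (toQ '' {a : Zd d | a ∈ A ∧ F a = 0}) with hW
      have hWd : Module.finrank ℚ W = d - 1 := by
        rw [hW, ← finrank_R_eq_Q]; exact hF.2.2
      have h1 : W ≤ LinearMap.ker h := by
        refine Submodule.span_le.2 ?_
        rintro _ ⟨b, ⟨hb, hb0⟩, rfl⟩
        change h (toQ b) = 0
        simp [hh, hf, hg, hb0, (hz b hb).1 hb0]
      have h2 : toQ a ∈ LinearMap.ker h := by
        rw [LinearMap.mem_ker]
        simp [hh, hf, hg, mul_comm]
      have h3 : toQ a ∉ W := by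
        intro h3
        have : W ≤ LinearMap.ker f := by
          refine Submodule.span_le.2 ?_
          rintro _ ⟨b, ⟨hb, hb0⟩, rfl⟩
          change f (toQ b) = 0
          simp [hf, hb0]
        have := this h3
        rw [LinearMap.mem_ker, hf] at this
        have : F a = 0 := by exact_mod_cast this
        omega
      have h4 : W < LinearMap.ker h := lt_of_le_of_ne h1 fun e => h3 (e ▸ h2)
      have h5 := Submodule.finrank_lt_finrank_of_lt h4
      have h6 : LinearMap.ker h = ⊤ := by
        apply Submodule.eq_top_of_finrank_eq
        have := Submodule.finrank_le (LinearMap.ker h)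
        simp only [Module.finrank_fin_fun] at this ⊢
        omega
      exact LinearMap.ker_eq_top.1 h6
    have hkey2 : ∀ y, G a * F y = F a * G y := by
      intro y
      have := congrArg (fun l => l (toQ y)) hkey
      simp [hf, hg] at this
      have h : (G a : ℚ) * F y = F a * G y := by linarith
      exact_mod_cast h
    obtain ⟨u, hu⟩ := hF.2.1 1
    obtain ⟨w, hw⟩ := hG.2.1 1
    have e1 : F a ∣ G a := ⟨G u, by rw [← hkey2, hu, mul_one]⟩
    have e2 : G a ∣ F a := ⟨F w, by rw [hkey2, hw, mul_one]⟩
    have e3 : F a = G a := Int.dvd_antisymm hFa.le hGa.le e1 e2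
    ext y
    have := hkey2 (Pi.single y 1)
    rw [e3] at this
    simpa using mul_left_cancel₀ hGa.ne' this

theorem NA_iff {d : ℕ} (A : Finset (Zd d)) (x : Zd d) :
    x ∈ NA A ↔ ∃ u : Zd d → ℕ, x = ∑ a ∈ A, u a • a := by
  classical
  constructor
  · intro hx
    unfold NA at hx
    induction hx using AddSubmonoid.closure_induction with
    | mem x hx => exact ⟨Pi.single x 1, by
        rw [Finset.sum_eq_single x]
        · simp
        · intro b _ hb; simp [hb]
        · intro h; exact absurd hx h⟩
    | zero => exact ⟨0, by simp⟩
    | add x y _ _ hx hy =>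
      obtain ⟨u, rfl⟩ := hx
      obtain ⟨w, rfl⟩ := hy
      exact ⟨u + w, by simp only [Pi.add_apply, add_smul, Finset.sum_add_distrib]⟩
  · rintro ⟨u, rfl⟩
    exact sum_mem fun a ha => nsmul_mem (AddSubmonoid.subset_closure ha) _

theorem fg_of_subset {d : ℕ} (A : Finset (Zd d)) (S : Set (Zd d)) (hS : IsNASet A S)
    (G₀ : Set (Zd d)) (hG₀ : G₀.Finite) (h : ∀ x ∈ S, ∃ g ∈ G₀, ∃ a ∈ NA A, x = g + a) :
    IsFGNASet A S := by
  classical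
  refine ⟨hS, ?_⟩
  let φ : (A → ℕ) → Zd d := fun u => ∑ a : A, u a • (a : Zd d)
  have hφ : ∀ u, φ u ∈ NA A := fun u =>
    sum_mem fun a _ => nsmul_mem (AddSubmonoid.subset_closure a.2) _
  have hφ' : ∀ x ∈ NA A, ∃ u, x = φ u := by
    intro x hx
    obtain ⟨u, rfl⟩ := (NA_iff A x).1 hx
    exact ⟨fun a => u a, by rw [← Finset.sum_coe_sort]⟩
  have hφa : ∀ u w, φ (u + w) = φ u + φ w := by
    intro u w; simp only [φ, Pi.add_apply, add_smul, Finset.sum_add_distrib]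
  let U : Zd d → Set (A → ℕ) := fun g => {u | g + φ u ∈ S}
  have hfin : ∀ g, {u | Minimal (· ∈ U g) u}.Finite := by
    intro g
    exact WellQuasiOrderedLE.finite_of_isAntichain (setOfPred_minimal_antichain _)
  have hT : (⋃ g ∈ G₀, (fun u => g + φ u) '' {u | Minimal (· ∈ U g) u}).Finite :=
    hG₀.biUnion fun g _ => (hfin g).image _
  refine ⟨hT.toFinset, ?_⟩
  ext x
  simp only [Set.mem_ofPred_eq, Set.Finite.mem_toFinset]
  constructor
  · intro hx
    obtain ⟨g, hg, a, ha, rfl⟩ := h x hx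
    obtain ⟨u, rfl⟩ := hφ' a ha
    obtain ⟨m, hmu, hm⟩ := exists_minimal_le_of_wellFoundedLT (· ∈ U g) u hx
    refine ⟨g + φ m, ?_, φ (u - m), hφ _, ?_⟩
    · simp only [Set.mem_iUnion]
      exact ⟨g, hg, m, hm, rfl⟩
    · rw [add_assoc, ← hφa, add_tsub_cancel_of_le hmu]
  · rintro ⟨y, hy, a, ha, rfl⟩
    simp only [Set.mem_iUnion] at hy
    obtain ⟨g, hg, m, hm, rfl⟩ := hy
    exact hS _ hm.prop _ ha

theorem cone_decomp {d : ℕ} (A : Finset (Zd d)) :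
    ∃ R : Set (Zd d), R.Finite ∧ ∀ x : Zd d,
      (∃ c : Zd d → ℚ, (∀ a, 0 ≤ c a) ∧ toQ x = ∑ a ∈ A, c a • toQ a) →
      ∃ r ∈ R, ∃ a ∈ NA A, x = r + a := by
  refine ⟨Set.Icc (fun i => -∑ a ∈ A, |a i|) (fun i => ∑ a ∈ A, |a i|), Set.finite_Icc _ _, ?_⟩
  rintro x ⟨c, hc, hx⟩
  refine ⟨x - ∑ a ∈ A, (⌊c a⌋₊) • a, ?_, _, (NA_iff A _).2 ⟨fun a => ⌊c a⌋₊, rfl⟩, by simp⟩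
  have key : ∀ i, |(x - ∑ a ∈ A, (⌊c a⌋₊) • a) i| ≤ ∑ a ∈ A, |a i| := by
    intro i
    have h1 : (((x - ∑ a ∈ A, (⌊c a⌋₊) • a) i : ℤ) : ℚ) = ∑ a ∈ A, (c a - ⌊c a⌋₊) * (a i : ℚ) := by
      have := congrFun hx i
      simp [toQ, Finset.sum_apply] at this
      simp [Finset.sum_apply, this, sub_mul, Finset.sum_sub_distrib]
    have h2 : |(((x - ∑ a ∈ A, (⌊c a⌋₊) • a) i : ℤ) : ℚ)| ≤ ∑ a ∈ A, |(a i : ℚ)| := by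
      rw [h1]
      refine (Finset.abs_sum_le_sum_abs _ _).trans (Finset.sum_le_sum fun a _ => ?_)
      rw [abs_mul]
      have h3 := Nat.floor_le (hc a)
      have h4 := Nat.lt_floor_add_one (c a)
      have h5 : |c a - ⌊c a⌋₊| ≤ 1 := by rw [abs_le]; constructor <;> linarith
      exact mul_le_of_le_one_left (abs_nonneg _) h5
    exact_mod_cast h2
  exact ⟨fun i => (abs_le.1 (key i)).1, fun i => (abs_le.1 (key i)).2⟩

theorem F_NA_nonneg {d : ℕ} (A : Finset (Zd d)) (F : Zd d →+ ℤ) (hF : ∀ a ∈ A, 0 ≤ F a)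
    (x : Zd d) (hx : x ∈ NA A) : 0 ≤ F x := by
  obtain ⟨u, rfl⟩ := (NA_iff A x).1 hx
  rw [map_sum]
  refine Finset.sum_nonneg fun a ha => ?_
  rw [map_nsmul]
  exact nsmul_nonneg (hF a ha) _

/-- Lemma 3.2. A scored `ℕA`-set `S_c` is finitely generated
if and only if `F_σ(S_c)` is a finitely generated `F_σ(ℕA)`-set for each facet `σ`. -/
theorem scored_fg_iff_facet_images_fg {d : ℕ} (A : Finset (Zd d))
    (hZ : ZA A = ⊤) (hconv : StronglyConvex A)
    (Sc : Set (Zd d)) (hNA : IsNASet A Sc) (hsc : IsScored A Sc) :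
    IsFGNASet A Sc ↔ ∀ F : Zd d →+ ℤ, IsFacetFn A F → IsFGFSet A F (F '' Sc) := by
  classical
  constructor
  · rintro ⟨_, G, hG⟩ F _
    refine ⟨G.image F, ?_⟩
    ext y
    constructor
    · rintro ⟨x, hx, rfl⟩
      rw [hG] at hx
      obtain ⟨g, hg, a, ha, rfl⟩ := hx
      exact ⟨F g, Finset.mem_image_of_mem _ hg, a, ha, map_add _ _ _⟩
    · rintro ⟨_, hg', a, ha, rfl⟩
      obtain ⟨g, hg, rfl⟩ := Finset.mem_image.1 hg'
      refine ⟨g + a, ?_, map_add _ _ _⟩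
      rw [hG]
      exact ⟨g, hg, a, ha, rfl⟩
  · intro h
    have hb : ∀ F : Zd d →+ ℤ, ∃ m : ℕ, IsFacetFn A F → ∀ s ∈ Sc, -(m : ℤ) ≤ F s := by
      intro F
      by_cases hF : IsFacetFn A F
      · obtain ⟨G, hG⟩ := h F hF
        refine ⟨∑ g ∈ G, g.natAbs, fun _ s hs => ?_⟩
        have : F s ∈ F '' Sc := ⟨s, hs, rfl⟩
        rw [hG] at this
        obtain ⟨g, hg, a, ha, e⟩ := this
        have h1 := F_NA_nonneg A F hF.1 a ha
        have h2 : g.natAbs ≤ ∑ g ∈ G, g.natAbs :=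
          Finset.single_le_sum (f := fun g : ℤ => g.natAbs) (fun _ _ => Nat.zero_le _) hg
        omega
      · exact ⟨0, fun h => absurd h hF⟩
    choose m hm using hb
    have hfin := facets_finite A hZ
    let N : ℕ := ∑ F ∈ hfin.toFinset, m F
    let b : Zd d := N • ∑ a ∈ A, a
    obtain ⟨R, hR, hdec⟩ := cone_decomp A
    refine fg_of_subset A Sc hNA ((fun r => r - b) '' R) (hR.image _) fun x hx => ?_
    obtain ⟨r, hr, a, ha, e⟩ := hdec (x + b) (mem_cone A hZ _ fun F hF => by
      have h1 := hm F hF x hx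
      have h2 : m F ≤ N := Finset.single_le_sum (f := m) (fun _ _ => Nat.zero_le _)
        (hfin.mem_toFinset.2 hF)
      obtain ⟨a, ha, hpos⟩ := exists_pos A hZ F hF
      have h3 : F a ≤ ∑ a ∈ A, F a := Finset.single_le_sum (f := fun a => F a)
        (fun a ha => hF.1 a ha) ha
      have h4 : F b = N * ∑ a ∈ A, F a := by
        simp only [b]; rw [map_nsmul, map_sum, nsmul_eq_mul]
      rw [map_add, h4]
      have h5 : (m F : ℤ) ≤ N := by exact_mod_cast h2
      nlinarith)
    refine ⟨r - b, ⟨r, hr, rfl⟩, a, ha, ?_⟩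
    rw [sub_add_eq_add_sub, ← e]; simp

end SaitoTakahashi
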